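/- arXiv:1906.09362 — 5 statements merged into one kernel-verified Lean document; each statement's English description precedes it below -/
import Mathlib

section
/- Let N be a positive natural number, H an N×N complex matrix, and let D be the ℂ-linear endomorphism of M_N(ℂ) given by D(X) = HX + XH (the anticommutator with H). Then for every natural number n, the trace of the linear map D^n equals ∑_{k=0}^{n} binomial(n,k) · Tr(H^{n−k}) · Tr(H^{k}). -/
/-- The trace of the two-sided multiplication `X ↦ X * B` after `X ↦ A * X` on square matrices
is `Tr A * Tr B`. -/
theorem trace_mulRight_mul_mulLeft {R ι : Type*} [CommRing R] [Fintype ι] [DecidableEq ι]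
    (A B : Matrix ι ι R) :
    LinearMap.trace R (Matrix ι ι R) (LinearMap.mulRight R B * LinearMap.mulLeft R A)
      = A.trace * B.trace := by
  rw [LinearMap.trace_eq_matrix_trace R (Matrix.stdBasis R ι ι), Matrix.trace, Matrix.trace,
    Matrix.trace, Finset.sum_mul_sum, Fintype.sum_prod_type]
  refine Finset.sum_congr rfl fun i _ => Finset.sum_congr rfl fun j _ => ?_
  have h (X : Matrix ι ι R) : (Matrix.stdBasis R ι ι).repr X (i, j) = X i j := by
    simp [Matrix.stdBasis]
  simp [LinearMap.toMatrix_apply, Matrix.stdBasis_eq_single, h, Matrix.mul_apply,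
    Matrix.single_apply, ite_and]

/-- For the Dirac operator `D(X) = H * X + X * H` of a type `(1,0)` matrix geometry,
the trace of `D ^ n` equals `∑ k ≤ n, (n choose k) * Tr(H^(n-k)) * Tr(H^k)`. -/
theorem trace_pow_anticommutator (N : ℕ) (hN : 0 < N)
    (H : Matrix (Fin N) (Fin N) ℂ)
    (D : Module.End ℂ (Matrix (Fin N) (Fin N) ℂ))
    (hD : ∀ X, D X = H * X + X * H) (n : ℕ) :
    LinearMap.trace ℂ (Matrix (Fin N) (Fin N) ℂ) (D ^ n)
      = ∑ k ∈ Finset.range (n + 1),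
          (n.choose k : ℂ) * (H ^ (n - k)).trace * (H ^ k).trace := by
  have h : D = LinearMap.mulRight ℂ H + LinearMap.mulLeft ℂ H := by
    refine LinearMap.ext fun X => ?_
    rw [hD, LinearMap.add_apply, LinearMap.mulLeft_apply, LinearMap.mulRight_apply, add_comm]
  rw [h, (LinearMap.commute_mulLeft_right H H).symm.add_pow, map_sum]
  refine Finset.sum_congr rfl fun k _ => ?_
  rw [LinearMap.pow_mulRight, LinearMap.pow_mulLeft, ← nsmul_eq_mul', map_nsmul,
    trace_mulRight_mul_mulLeft, nsmul_eq_mul, mul_assoc]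
end

section
/- Let N be a positive natural number and H an N×N Hermitian complex matrix. The spectrum of the ℂ-linear endomorphism D of M_N(ℂ) given by D(X) = HX + XH equals the sumset of the spectrum of H with itself: spec(D) = { μ + ν : μ ∈ spec(H), ν ∈ spec(H) }. -/
open Matrix

namespace Matrix

variable {n K : Type*} [Fintype n] [DecidableEq n] [Field K]

theorem mem_spectrum_iff_exists_mulVec {A : Matrix n n K} {μ : K} :
    μ ∈ spectrum K A ↔ ∃ v ≠ 0, A *ᵥ v = μ • v := by
  rw [spectrum.mem_iff, isUnit_iff_isUnit_det, isUnit_iff_ne_zero, not_not,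
    ← exists_mulVec_eq_zero_iff]
  simp only [Algebra.algebraMap_eq_smul_one, sub_mulVec, smul_mulVec, one_mulVec, sub_eq_zero,
    eq_comm]

theorem mem_spectrum_iff_exists_vecMul {A : Matrix n n K} {μ : K} :
    μ ∈ spectrum K A ↔ ∃ v ≠ 0, v ᵥ* A = μ • v := by
  rw [spectrum.mem_iff, isUnit_iff_isUnit_det, isUnit_iff_ne_zero, not_not,
    ← exists_vecMul_eq_zero_iff]
  simp only [Algebra.algebraMap_eq_smul_one, vecMul_sub, vecMul_smul, vecMul_one, sub_eq_zero,
    eq_comm]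

theorem IsHermitian.exists_mulVec_eigenvectorBasis_ne_zero {𝕜 : Type*} [RCLike 𝕜]
    {A X : Matrix n n 𝕜} (hA : A.IsHermitian) (hX : X ≠ 0) :
    ∃ j, X *ᵥ ⇑(hA.eigenvectorBasis j) ≠ 0 := by
  by_contra! h
  refine hX (toEuclideanLin.injective (hA.eigenvectorBasis.toBasis.ext fun j => ?_))
  simp [toLpLin_apply, h]

end Matrix

/-- The spectrum of the Dirac operator `D(X) = H * X + X * H` on `M_N(ℂ)`, for a
Hermitian matrix `H`, is the sumset of the spectrum of `H` with itself. -/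
theorem spectrum_anticommutator (N : ℕ) (hN : 0 < N)
    (H : Matrix (Fin N) (Fin N) ℂ) (hH : H = Hᴴ)
    (D : Module.End ℂ (Matrix (Fin N) (Fin N) ℂ))
    (hD : ∀ X, D X = H * X + X * H) :
    spectrum ℂ D = Set.image2 (· + ·) (spectrum ℂ H) (spectrum ℂ H) := by
  ext l
  rw [← Module.End.hasEigenvalue_iff_mem_spectrum]
  constructor
  · intro hl
    obtain ⟨X, hX⟩ := hl.exists_hasEigenvector
    have hA : H.IsHermitian := hH.symm
    obtain ⟨j, hj⟩ := hA.exists_mulVec_eigenvectorBasis_ne_zero hX.2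
    have hv : H *ᵥ ⇑(hA.eigenvectorBasis j) =
        (hA.eigenvalues j : ℂ) • ⇑(hA.eigenvectorBasis j) := hA.mulVec_eigenvectorBasis j
    have hDX : H * X = l • X - X * H := by
      rw [eq_sub_iff_add_eq, ← hD, hX.apply_eq_smul]
    refine ⟨l - hA.eigenvalues j, mem_spectrum_iff_exists_mulVec.2 ⟨_, hj, ?_⟩,
      hA.eigenvalues j, mem_spectrum_iff_exists_mulVec.2 ⟨_, ?_, hv⟩, sub_add_cancel _ _⟩
    · rw [mulVec_mulVec, hDX, sub_mulVec, smul_mulVec, ← mulVec_mulVec, hv, mulVec_smul, sub_smul]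
    · rintro h
      exact hj (by rw [h, mulVec_zero])
  · rintro ⟨μ, hμ, ν, hν, rfl⟩
    obtain ⟨u, hu, hHu⟩ := mem_spectrum_iff_exists_mulVec.1 hμ
    obtain ⟨v, hv, hvH⟩ := mem_spectrum_iff_exists_vecMul.1 hν
    refine Module.End.hasEigenvalue_of_hasEigenvector (x := vecMulVec u v)
      ⟨Module.End.mem_eigenspace_iff.2 ?_, vecMulVec_ne_zero hu hv⟩
    rw [hD, mul_vecMulVec, vecMulVec_mul, hHu, hvH, smul_vecMulVec, vecMulVec_smul, add_smul]
end

section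
/- Let f be a complex-analytic function on a neighborhood of a point p ∈ ℂ with f'(p) ≠ 0. Then the function (v, w) ↦ f'(v)·f'(w)/(f(v) − f(w))² − 1/(v − w)², defined for pairs with v ≠ w, converges to (1/6)·(Sf)(p) as (v, w) → (p, p) within the set { (v,w) : v ≠ w }, where (Sf)(p) = f'''(p)/f'(p) − (3/2)·(f''(p)/f'(p))² is the Schwarzian derivative of f at p. -/
open Filter

open Asymptotics Topology in
/-- Integrating an `o((v - w) ^ n)` bound, uniform in the base point `w`, in the variable `v`. -/
theorem isLittleO_sub_pow_succ_of_hasDerivAt {G G' : ℂ → ℂ → ℂ} {p : ℂ} {n : ℕ}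
    (hG : ∀ w, G w w = 0)
    (hd : ∀ᶠ x : ℂ × ℂ in 𝓝 (p, p), HasDerivAt (G x.2) (G' x.2 x.1) x.1)
    (ho : (fun x : ℂ × ℂ => G' x.2 x.1) =o[𝓝 (p, p)] fun x => (x.1 - x.2) ^ n) :
    (fun x : ℂ × ℂ => G x.2 x.1) =o[𝓝 (p, p)] fun x => (x.1 - x.2) ^ (n + 1) := by
  refine isLittleO_iff.2 fun ε hε => ?_
  obtain ⟨r, hr, hball⟩ := Metric.eventually_nhds_iff_ball.1 (hd.and (ho.def hε))
  filter_upwards [Metric.ball_mem_nhds _ hr] with x hx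
  rw [← ball_prod_same] at hx hball
  have hseg : segment ℝ x.2 x.1 ⊆ Metric.ball p r :=
    (convex_ball p r).segment_subset hx.2 hx.1
  have key := Convex.norm_image_sub_le_of_norm_hasDerivWithin_le (f := G x.2) (f' := G' x.2)
    (C := ε * ‖x.1 - x.2‖ ^ n)
    (fun z hz => (hball (z, x.2) ⟨hseg hz, hx.2⟩).1.hasDerivWithinAt)
    (fun z hz => by
      refine (hball (z, x.2) ⟨hseg hz, hx.2⟩).2.trans ?_
      rw [norm_pow]
      gcongr
      exact norm_sub_le_of_mem_segment hz)
    (convex_segment _ _) (left_mem_segment ℝ _ _) (right_mem_segment ℝ _ _)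
  rw [hG, sub_zero] at key
  rwa [norm_pow, pow_succ, ← mul_assoc]

/-- The Schwarzian derivative as the constant term of the expansion of
`f'(v) f'(w) / (f(v) − f(w))² − 1/(v − w)²` near the diagonal: for `f` analytic
at `p` with `f'(p) ≠ 0`, this expression tends to `(1/6)·(Sf)(p)` as
`(v, w) → (p, p)` off the diagonal, where
`(Sf)(p) = f'''(p)/f'(p) − (3/2)(f''(p)/f'(p))²`. -/
theorem schwarzian_from_bidifferential (f : ℂ → ℂ) (p : ℂ)
    (hf : AnalyticAt ℂ f p) (hf' : deriv f p ≠ 0) :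
    Tendsto
      (fun vw : ℂ × ℂ =>
        deriv f vw.1 * deriv f vw.2 / (f vw.1 - f vw.2) ^ 2
          - 1 / (vw.1 - vw.2) ^ 2)
      (nhdsWithin (p, p) {vw : ℂ × ℂ | vw.1 ≠ vw.2})
      (nhds ((1 / 6) *
        (iteratedDeriv 3 f p / deriv f p
          - (3 / 2) * (iteratedDeriv 2 f p / deriv f p) ^ 2))) := by
  have e2 : iteratedDeriv 2 f = deriv (deriv f) := by
    rw [iteratedDeriv_succ, iteratedDeriv_one]
  have e3 : iteratedDeriv 3 f p = deriv (deriv (deriv f)) p := by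
    rw [iteratedDeriv_succ, e2]
  rw [e3, e2]
  set C := deriv (deriv (deriv f)) p
  have an1 := hf.deriv
  have an2 := an1.deriv
  have lift_fst {P : ℂ → Prop} (h : ∀ᶠ z in nhds p, P z) :
      ∀ᶠ x : ℂ × ℂ in nhds (p, p), P x.1 := (continuous_fst.tendsto (p, p)).eventually h
  have taylor2 : (fun x : ℂ × ℂ => deriv (deriv f) x.1 - deriv (deriv f) x.2 - C * (x.1 - x.2))
      =o[nhds (p, p)] fun x => (x.1 - x.2) ^ 1 := by
    simpa [mul_comm] using an2.hasStrictDerivAt.isLittleO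
  have taylor1 := isLittleO_sub_pow_succ_of_hasDerivAt
    (G := fun w v => deriv f v - deriv f w - deriv (deriv f) w * (v - w) - C / 2 * (v - w) ^ 2)
    (G' := fun w v => deriv (deriv f) v - deriv (deriv f) w - C * (v - w)) (by simp)
    (by
      filter_upwards [lift_fst an1.eventually_analyticAt] with x hx
      have hid := (hasDerivAt_id x.1).sub_const x.2
      refine (((hx.differentiableAt.hasDerivAt.sub_const _).sub (hid.const_mul _)).sub
        ((hid.pow 2).const_mul _)).congr_deriv ?_
      simp only [id]; push_cast; ring) taylor2
  have taylor0 := isLittleO_sub_pow_succ_of_hasDerivAt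
    (G := fun w v => f v - f w - deriv f w * (v - w) - deriv (deriv f) w / 2 * (v - w) ^ 2
      - C / 6 * (v - w) ^ 3)
    (G' := fun w v => deriv f v - deriv f w - deriv (deriv f) w * (v - w) - C / 2 * (v - w) ^ 2)
    (by simp)
    (by
      filter_upwards [lift_fst hf.eventually_analyticAt] with x hx
      have hid := (hasDerivAt_id x.1).sub_const x.2
      refine ((((hx.differentiableAt.hasDerivAt.sub_const _).sub (hid.const_mul _)).sub
        ((hid.pow 2).const_mul _)).sub ((hid.pow 3).const_mul _)).congr_deriv ?_
      simp only [id]; push_cast; ring) taylor1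
  set L := nhdsWithin (p, p) {vw : ℂ × ℂ | vw.1 ≠ vw.2}
  have hL : L ≤ nhds (p, p) := nhdsWithin_le_nhds
  have t1 := taylor1.tendsto_div_nhds_zero.mono_left hL
  have t0 := taylor0.tendsto_div_nhds_zero.mono_left hL
  norm_num only at t0 t1
  set r1 : ℂ × ℂ → ℂ := fun x => (deriv f x.1 - deriv f x.2 - deriv (deriv f) x.2 * (x.1 - x.2)
    - C / 2 * (x.1 - x.2) ^ 2) / (x.1 - x.2) ^ 2 with hr1
  set r0 : ℂ × ℂ → ℂ := fun x => (f x.1 - f x.2 - deriv f x.2 * (x.1 - x.2)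
    - deriv (deriv f) x.2 / 2 * (x.1 - x.2) ^ 2 - C / 6 * (x.1 - x.2) ^ 3)
    / (x.1 - x.2) ^ 3 with hr0
  have ta : Tendsto (fun x : ℂ × ℂ => deriv f x.2) L (nhds (deriv f p)) :=
    (an1.continuousAt.tendsto.comp (continuous_snd.tendsto (p, p))).mono_left hL
  have tb : Tendsto (fun x : ℂ × ℂ => deriv (deriv f) x.2) L (nhds (deriv (deriv f) p)) :=
    (an2.continuousAt.tendsto.comp (continuous_snd.tendsto (p, p))).mono_left hL
  have th : Tendsto (fun x : ℂ × ℂ => x.1 - x.2) L (nhds 0) := by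
    have hc : Continuous fun x : ℂ × ℂ => x.1 - x.2 := by fun_prop
    simpa using (hc.tendsto (p, p)).mono_left hL
  have tk : Tendsto (fun x => C / 6 + r0 x) L (nhds (C / 6)) := by
    simpa using t0.const_add (C / 6)
  have tq := (ta.add ((tb.div_const 2).mul th)).add ((th.pow 2).mul tk)
  have tn := ((((ta.mul_const (C / 2)).add (ta.mul t1)).sub ((tb.pow 2).div_const 4)).sub
    ((ta.const_mul 2).mul tk)).sub ((tb.mul tk).mul th) |>.sub ((th.pow 2).mul (tk.pow 2))
  have hq0 : deriv f p + deriv (deriv f) p / 2 * 0 + 0 ^ 2 * (C / 6) ≠ 0 := by simpa using hf'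
  have main := tn.div (tq.pow 2) (pow_ne_zero 2 hq0)
  convert main.congr' ?_ using 2
  · field_simp
    ring
  · filter_upwards [tq.eventually_ne hq0, self_mem_nhdsWithin] with x hq hx
    have hh : x.1 - x.2 ≠ 0 := sub_ne_zero.2 hx
    have hf1 : deriv f x.1 = deriv f x.2 + deriv (deriv f) x.2 * (x.1 - x.2)
        + C / 2 * (x.1 - x.2) ^ 2 + (x.1 - x.2) ^ 2 * r1 x := by
      simp only [hr1]; field_simp; ring
    have hf0 : f x.1 - f x.2 = (x.1 - x.2) * (deriv f x.2 + deriv (deriv f) x.2 / 2 * (x.1 - x.2)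
        + (x.1 - x.2) ^ 2 * (C / 6 + r0 x)) := by
      simp only [hr0]; field_simp; ring
    simp only [Pi.div_apply]
    have split {N F q h : ℂ} (hq : q ≠ 0) (hh : h ≠ 0) (hN : F - q ^ 2 = h ^ 2 * N) :
        N / q ^ 2 = F / (h * q) ^ 2 - 1 / h ^ 2 := by
      field_simp
      linear_combination -hN
    rw [hf0, hf1]
    refine split hq hh ?_
    ring
end

section
/- Let φ : ℝ → ℝ be a continuous function with compact support, and for x ∈ ℂ ∖ ℝ define W(x) = ∫_ℝ φ(s)/(x − s) ds. Then for every s₀ ∈ ℝ, the difference quotient (1/(2πi))·( W(s₀ − iε) − W(s₀ + iε) ) converges to φ(s₀) as ε → 0⁺. (Sokhotski–Plemelj recovery of the density from the jump discontinuity of its Stieltjes transform.) -/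
open Filter MeasureTheory

/-- Poisson kernel averages of a bounded continuous function, in rescaled form, converge to
`π` times the value of the function at the center. -/
theorem tendsto_integral_inv_one_add_sq_mul_comp {φ : ℝ → ℝ} (hφ : Continuous φ) {C : ℝ}
    (hC : ∀ x, ‖φ x‖ ≤ C) (s₀ : ℝ) :
    Tendsto (fun ε : ℝ => ∫ t : ℝ, (1 + t ^ 2)⁻¹ * φ (s₀ + ε * t)) (nhds 0)
      (nhds (Real.pi * φ s₀)) := by
  rw [← integral_univ_inv_one_add_sq, ← integral_mul_const]
  refine tendsto_integral_filter_of_dominated_convergence (fun t => (1 + t ^ 2)⁻¹ * C)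
    (.of_forall fun ε => ?_) (.of_forall fun ε => .of_forall fun t => ?_)
    (integrable_inv_one_add_sq.mul_const C) (.of_forall fun t => ?_)
  · exact integrable_inv_one_add_sq.aestronglyMeasurable.mul
      (by fun_prop : Continuous fun t => φ (s₀ + ε * t)).aestronglyMeasurable
  · rw [norm_mul, Real.norm_of_nonneg (by positivity)]
    gcongr
    exact hC _
  · have h : Continuous fun ε => (1 + t ^ 2)⁻¹ * φ (s₀ + ε * t) := by fun_prop
    simpa using h.tendsto 0

/-- The Poisson integral after the substitution `s = s₀ + ε * t`. -/
theorem integral_mul_poisson_eq_integral_inv_one_add_sq (φ : ℝ → ℝ) (s₀ : ℝ) {ε : ℝ}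
    (hε : 0 < ε) :
    ∫ s : ℝ, φ s * (ε / ((s₀ - s) ^ 2 + ε ^ 2)) =
      ∫ t : ℝ, (1 + t ^ 2)⁻¹ * φ (s₀ + ε * t) := by
  have hscale := Measure.integral_comp_mul_left
    (fun y => φ (s₀ + y) * (ε / ((s₀ - (s₀ + y)) ^ 2 + ε ^ 2))) ε
  rw [integral_add_left_eq_self (fun s => φ s * (ε / ((s₀ - s) ^ 2 + ε ^ 2))) s₀,
    abs_of_pos (inv_pos.mpr hε), eq_comm, inv_smul_eq_iff₀ hε.ne', ← integral_smul] at hscale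
  rw [hscale]
  congr 1 with t
  have h : 0 < 1 + t ^ 2 := by positivity
  have h' : (s₀ - (s₀ + ε * t)) ^ 2 + ε ^ 2 = ε ^ 2 * (1 + t ^ 2) := by ring
  rw [h', smul_eq_mul]
  field_simp

/-- The Stieltjes integrand of a continuous compactly supported density is integrable off the
real axis. -/
theorem integrable_div_sub_ofReal {φ : ℝ → ℝ} (hφ : Continuous φ) (hsupp : HasCompactSupport φ)
    {z : ℂ} (hz : z.im ≠ 0) : Integrable fun s : ℝ => (φ s : ℂ) / (z - (s : ℂ)) := by
  have hne (s : ℝ) : z - (s : ℂ) ≠ 0 := fun h => hz (by simpa using congrArg Complex.im h)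
  refine Continuous.integrable_of_hasCompactSupport
    ((Complex.continuous_ofReal.comp hφ).div (by fun_prop) hne) ?_
  refine hsupp.mono fun s hs h => hs ?_
  simp [h]

/-- The jump of the Stieltjes transform across the real axis is a Poisson integral. -/
theorem stieltjes_jump_eq_integral_poisson {φ : ℝ → ℝ} (hφ : Continuous φ)
    (hsupp : HasCompactSupport φ) (s₀ : ℝ) {ε : ℝ} (hε : ε ≠ 0) :
    (∫ s : ℝ, (φ s : ℂ) / (((s₀ : ℂ) - ε * Complex.I) - (s : ℂ)))
        - ∫ s : ℝ, (φ s : ℂ) / (((s₀ : ℂ) + ε * Complex.I) - (s : ℂ)) =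
      2 * Complex.I * ((∫ s : ℝ, φ s * (ε / ((s₀ - s) ^ 2 + ε ^ 2)) : ℝ) : ℂ) := by
  rw [← integral_sub (integrable_div_sub_ofReal hφ hsupp (by simpa using hε))
    (integrable_div_sub_ofReal hφ hsupp (by simpa using hε)), ← integral_complex_ofReal,
    ← integral_const_mul]
  congr 1 with s
  have h₁ : (s₀ : ℂ) - ε * Complex.I - s ≠ 0 := fun h =>
    hε (by simpa using congrArg Complex.im h)
  have h₂ : (s₀ : ℂ) + ε * Complex.I - s ≠ 0 := fun h =>
    hε (by simpa using congrArg Complex.im h)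
  have h₃ : ((s₀ : ℂ) - s) ^ 2 + ε ^ 2 =
      (s₀ - ε * Complex.I - s) * (s₀ + ε * Complex.I - s) := by
    linear_combination (ε : ℂ) ^ 2 * Complex.I_sq
  push_cast
  rw [h₃]
  field_simp
  ring

/-- Sokhotski–Plemelj: for a continuous compactly supported density `φ`, with
`W(x) = ∫ φ(s)/(x − s) ds`, the jump `(1/(2πi))·(W(s₀ − iε) − W(s₀ + iε))`
converges to `φ(s₀)` as `ε → 0⁺`. -/
theorem sokhotski_plemelj (φ : ℝ → ℝ) (hφ : Continuous φ)
    (hsupp : HasCompactSupport φ) (s₀ : ℝ) :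
    Tendsto
      (fun ε : ℝ =>
        (1 / (2 * Real.pi * Complex.I)) *
          ((∫ s : ℝ, (φ s : ℂ) / (((s₀ : ℂ) - ε * Complex.I) - (s : ℂ)))
            - ∫ s : ℝ, (φ s : ℂ) / (((s₀ : ℂ) + ε * Complex.I) - (s : ℂ))))
      (nhdsWithin 0 (Set.Ioi 0)) (nhds ((φ s₀ : ℂ))) := by
  obtain ⟨C, hC⟩ := hsupp.exists_bound_of_continuous hφ
  have hlim := ((tendsto_integral_inv_one_add_sq_mul_comp hφ hC s₀).mono_left
    (nhdsWithin_le_nhds (s := Set.Ioi 0))).const_mul Real.pi⁻¹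
  rw [inv_mul_cancel_left₀ Real.pi_ne_zero] at hlim
  refine ((Complex.continuous_ofReal.tendsto _).comp hlim).congr' ?_
  filter_upwards [self_mem_nhdsWithin] with ε (hε : 0 < ε)
  have hpi : (Real.pi : ℂ) ≠ 0 := Complex.ofReal_ne_zero.mpr Real.pi_ne_zero
  rw [stieltjes_jump_eq_integral_poisson hφ hsupp s₀ hε.ne',
    integral_mul_poisson_eq_integral_inv_one_add_sq φ s₀ hε, Function.comp_apply,
    Complex.ofReal_mul, Complex.ofReal_inv]
  generalize ∫ t : ℝ, (1 + t ^ 2)⁻¹ * φ (s₀ + ε * t) = J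
  field_simp [Complex.I_ne_zero]
end

section
/- Let α be a finite type with decidable equality and let W be a function assigning a complex number to each nonempty finite subset of α. Define M(S) = ∑_{P} ∏_{B ∈ parts(P)} W(B), where the sum ranges over all finite partitions P of the finite set S. Then for every nonempty finite subset S of α, W(S) = ∑_{P} (−1)^{|parts(P)| − 1} · (|parts(P)| − 1)! · ∏_{B ∈ parts(P)} M(B), where the sum again ranges over all finite partitions P of S. (The moment–cumulant inversion over the lattice of set partitions, relating disconnected correlators Ŵ_n and connected correlators W_n.) -/
/-- The subset convolution of two functions on finite sets. -/
def subsetConv {α R : Type*} [DecidableEq α] [CommRing R] (f g : Finset α → R)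
    (s : Finset α) : R :=
  ∑ t ∈ s.powerset, f t * g (s \ t)

theorem subsetConv_assoc {α R : Type*} [DecidableEq α] [CommRing R]
    (f g h : Finset α → R) (s : Finset α) :
    subsetConv (subsetConv f g) h s = subsetConv f (subsetConv g h) s := by
  simp only [subsetConv, Finset.sum_mul, Finset.mul_sum, Finset.sum_sigma']
  refine Finset.sum_bij' (fun x _ => ⟨x.2, x.1 \ x.2⟩) (fun x _ => ⟨x.1 ∪ x.2, x.1⟩)
    ?_ ?_ ?_ ?_ ?_
  · rintro ⟨t, u⟩ hx
    simp only [Finset.mem_sigma, Finset.mem_powerset] at hx ⊢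
    exact ⟨hx.2.trans hx.1, Finset.sdiff_subset_sdiff hx.1 subset_rfl⟩
  · rintro ⟨u, v⟩ hx
    simp only [Finset.mem_sigma, Finset.mem_powerset] at hx ⊢
    exact ⟨Finset.union_subset hx.1 (hx.2.trans Finset.sdiff_subset),
      Finset.subset_union_left⟩
  · rintro ⟨t, u⟩ hx
    simp only [Finset.mem_sigma, Finset.mem_powerset] at hx
    simp [Finset.union_sdiff_of_subset hx.2]
  · rintro ⟨u, v⟩ hx
    simp only [Finset.mem_sigma, Finset.mem_powerset] at hx
    have huv : Disjoint u v := (Finset.subset_sdiff.1 hx.2).2.symm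
    simp [Finset.union_sdiff_cancel_left huv]
  · rintro ⟨t, u⟩ hx
    simp only [Finset.mem_sigma, Finset.mem_powerset] at hx
    have hst : (s \ u) \ (t \ u) = s \ t := by
      ext x
      have := @hx.2 x
      simp only [Finset.mem_sdiff]
      tauto
    simp only [hst, mul_assoc]

/-- Summing over partitions with a marked block amounts to summing over the marked block and
the partitions of its complement. -/
theorem Finpartition.sum_sum_parts_erase {α R : Type*} [DecidableEq α] [AddCommMonoid R]
    (s : Finset α) (F : Finset α → Finset (Finset α) → R) :
    ∑ P : Finpartition s, ∑ B ∈ P.parts, F B (P.parts.erase B) =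
      ∑ U ∈ s.powerset with U.Nonempty, ∑ Q : Finpartition (s \ U), F U Q.parts := by
  have notMem {U : Finset α} (hU : U.Nonempty) (Q : Finpartition (s \ U)) : U ∉ Q.parts := by
    intro h
    obtain ⟨x, hx⟩ := hU
    exact (Finset.mem_sdiff.1 (Q.subset h hx)).2 hx
  simp only [Finset.sum_sigma']
  symm
  refine Finset.sum_bij
    (fun x hx => ⟨x.2.extend (b := x.1) (c := s)
      (by
        simp only [Finset.mem_sigma, Finset.mem_filter] at hx
        exact hx.1.2.ne_empty)
      Finset.sdiff_disjoint
      (by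
        simp only [Finset.mem_sigma, Finset.mem_filter, Finset.mem_powerset] at hx
        exact Finset.sdiff_union_of_subset hx.1.1), x.1⟩) ?_ ?_ ?_ ?_
  · rintro ⟨U, Q⟩ hx
    simp
  · rintro ⟨U, Q⟩ hx ⟨U', Q'⟩ hx' h
    simp only [Finset.mem_sigma, Finset.mem_filter] at hx
    simp only [Sigma.mk.injEq, heq_eq_eq] at h
    obtain ⟨h, rfl⟩ := h
    have h' : insert U Q.parts = insert U Q'.parts := congrArg Finpartition.parts h
    have : Q.parts = Q'.parts := by
      rw [← Finset.erase_insert (notMem hx.1.2 Q), h', Finset.erase_insert (notMem hx.1.2 Q')]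
    rw [Finpartition.ext this]
  · rintro ⟨P, B⟩ hx
    simp only [Finset.mem_sigma, Finset.mem_univ, true_and] at hx
    have hsup : (P.parts.erase B).sup id = s \ B := by
      ext x
      simp only [Finset.mem_sup, Finset.mem_erase, id, Finset.mem_sdiff]
      constructor
      · rintro ⟨C, ⟨hC, hCP⟩, hxC⟩
        exact ⟨P.subset hCP hxC, fun hxB => hC (P.eq_of_mem_parts hCP hx hxC hxB)⟩
      · rintro ⟨hxs, hxB⟩
        obtain ⟨C, hC, hxC⟩ := P.exists_mem hxs
        exact ⟨C, ⟨fun h => hxB (h ▸ hxC), hC⟩, hxC⟩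
    refine ⟨⟨B, P.ofSubset (Finset.erase_subset B P.parts) hsup⟩, ?_, ?_⟩
    · simp [P.subset hx, P.nonempty_of_mem_parts hx]
    · simp only [Sigma.mk.injEq, heq_eq_eq, and_true]
      apply Finpartition.ext
      exact Finset.insert_erase hx
  · rintro ⟨U, Q⟩ hx
    simp only [Finset.mem_sigma, Finset.mem_filter] at hx
    simp [Finpartition.extend, Finset.erase_insert (notMem hx.1.2 Q)]

/-- The sum over partitions of the product of `f` over the blocks, weighted by a function of
the number of blocks. -/
def partitionSum {α R : Type*} [DecidableEq α] [CommRing R] (c : ℕ → R) (f : Finset α → R)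
    (s : Finset α) : R :=
  ∑ P : Finpartition s, c P.parts.card * ∏ B ∈ P.parts, f B

theorem partitionSum_empty {α R : Type*} [DecidableEq α] [CommRing R] (c : ℕ → R)
    (f : Finset α → R) : partitionSum c f ∅ = c 0 := by
  have h (P : Finpartition (∅ : Finset α)) : P.parts = ∅ := P.parts_eq_empty_iff.2 rfl
  have hcard : Fintype.card (Finpartition (∅ : Finset α)) = 1 :=
    Fintype.card_eq_one_iff.2
      ⟨Finpartition.empty _, fun P => Finpartition.ext ((h P).trans (h _).symm)⟩
  simp [partitionSum, h, hcard]

/-- Splitting off the block containing `a`. -/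
theorem partitionSum_eq_subsetConv {α R : Type*} [DecidableEq α] [CommRing R] (c : ℕ → R)
    (f : Finset α → R) {s : Finset α} {a : α} (ha : a ∈ s) :
    partitionSum c f s =
      subsetConv (fun t => if a ∈ t then f t else 0) (partitionSum (fun k => c (k + 1)) f) s := by
  have key := Finpartition.sum_sum_parts_erase s
    (fun B p => if a ∈ B then c (p.card + 1) * (f B * ∏ C ∈ p, f C) else 0)
  have hl : ∀ P : Finpartition s, (∑ B ∈ P.parts, if a ∈ B then
      c ((P.parts.erase B).card + 1) * (f B * ∏ C ∈ P.parts.erase B, f C) else 0) =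
      c P.parts.card * ∏ B ∈ P.parts, f B := by
    intro P
    rw [Finset.sum_eq_single_of_mem (P.part a) (P.part_mem.2 ha)]
    · rw [if_pos (P.mem_part_self.2 ha), Finset.card_erase_add_one (P.part_mem.2 ha),
        Finset.mul_prod_erase _ _ (P.part_mem.2 ha)]
    · intro B hB hne
      exact if_neg fun h => hne (P.part_eq_of_mem hB h).symm
  rw [Finset.sum_congr rfl fun P _ => hl P] at key
  rw [partitionSum, key, subsetConv, Finset.sum_filter]
  refine Finset.sum_congr rfl fun U _ => ?_
  by_cases haU : a ∈ U
  · have hU : U.Nonempty := ⟨a, haU⟩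
    simp only [haU, hU, if_true, partitionSum, Finset.mul_sum]
    exact Finset.sum_congr rfl fun Q _ => by ring
  · simp [haU]

/-- The partition sum with weights `(-1) ^ k * k!` is the inverse of `f` under subset
convolution. -/
theorem subsetConv_partitionSum_factorial {α R : Type*} [DecidableEq α] [CommRing R]
    (f : Finset α → R) (hf : f ∅ = 1) (s : Finset α) :
    subsetConv f (partitionSum (fun k => (-1) ^ k * (k.factorial : R)) f) s =
      if s = ∅ then 1 else 0 := by
  split_ifs with hs
  · subst hs
    simp [subsetConv, partitionSum_empty, hf]
  · have key := Finpartition.sum_sum_parts_erase s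
      (fun B p => (-1) ^ (p.card + 1) * (p.card.factorial : R) * (f B * ∏ C ∈ p, f C))
    have hl : ∀ P : Finpartition s, (∑ B ∈ P.parts,
        (-1) ^ ((P.parts.erase B).card + 1) * ((P.parts.erase B).card.factorial : R) *
          (f B * ∏ C ∈ P.parts.erase B, f C)) =
        (-1) ^ P.parts.card * (P.parts.card.factorial : R) * ∏ B ∈ P.parts, f B := by
      intro P
      have hpos : P.parts.card ≠ 0 :=
        (Finset.card_pos.2 (P.parts_nonempty hs)).ne'
      have hterm : ∀ B ∈ P.parts,
          (-1) ^ ((P.parts.erase B).card + 1) * ((P.parts.erase B).card.factorial : R) *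
            (f B * ∏ C ∈ P.parts.erase B, f C) =
          (-1) ^ P.parts.card * ((P.parts.card - 1).factorial : R) * ∏ B ∈ P.parts, f B := by
        intro B hB
        rw [Finset.card_erase_add_one hB, Finset.card_erase_of_mem hB,
          Finset.mul_prod_erase _ _ hB]
      rw [Finset.sum_congr rfl hterm, Finset.sum_const, nsmul_eq_mul,
        ← Nat.mul_factorial_pred hpos]
      push_cast
      ring
    rw [Finset.sum_congr rfl fun P _ => hl P] at key
    have hempty : s.powerset.filter (fun U => ¬ U.Nonempty) = {∅} := by
      ext U
      simp only [Finset.mem_filter, Finset.mem_powerset, Finset.not_nonempty_iff_eq_empty,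
        Finset.mem_singleton]
      exact ⟨fun h => h.2, fun h => ⟨h ▸ Finset.empty_subset s, h⟩⟩
    rw [subsetConv, ← Finset.sum_filter_add_sum_filter_not _ (fun U => U.Nonempty), hempty,
      Finset.sum_singleton, hf, Finset.sdiff_empty, one_mul]
    conv_lhs => arg 2; rw [partitionSum, key]
    rw [← Finset.sum_add_distrib]
    refine Finset.sum_eq_zero fun U _ => ?_
    rw [partitionSum, Finset.mul_sum, ← Finset.sum_add_distrib]
    exact Finset.sum_eq_zero fun Q _ => by ring

/-- Moment–cumulant inversion over the lattice of set partitions: if the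
disconnected correlators are defined from the connected ones by
`M(S) = ∑_{P ⊢ S} ∏_{B ∈ P} W(B)`, then
`W(S) = ∑_{P ⊢ S} (−1)^{|P|−1} (|P|−1)! ∏_{B ∈ P} M(B)` for every nonempty `S`. -/
theorem moment_cumulant_inversion {α : Type*} [Fintype α] [DecidableEq α]
    (W M : Finset α → ℂ)
    (hM : ∀ s : Finset α, M s = ∑ P : Finpartition s, ∏ B ∈ P.parts, W B)
    (S : Finset α) (hS : S.Nonempty) :
    W S = ∑ P : Finpartition S,
        (-1 : ℂ) ^ (P.parts.card - 1) * ((P.parts.card - 1).factorial : ℂ) *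
          ∏ B ∈ P.parts, M B := by
  obtain ⟨a, ha⟩ := hS
  have hMW : M = partitionSum (fun _ => 1) W := by
    funext s
    simp only [hM, partitionSum, one_mul]
  have hM0 : M ∅ = 1 := by rw [hMW, partitionSum_empty]
  have hMa : (fun t => if a ∈ t then M t else 0) =
      subsetConv (fun t => if a ∈ t then W t else 0) M := by
    funext t
    split_ifs with hat
    · rw [hMW]
      exact partitionSum_eq_subsetConv _ W hat
    · refine (Finset.sum_eq_zero fun U hU => ?_).symm
      have haU : a ∉ U := fun h => hat (Finset.mem_powerset.1 hU h)
      simp [haU]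
  change W S = partitionSum (fun k => (-1) ^ (k - 1) * ((k - 1).factorial : ℂ)) M S
  rw [partitionSum_eq_subsetConv _ M ha, hMa, subsetConv_assoc]
  simp only [Nat.add_sub_cancel]
  rw [funext (subsetConv_partitionSum_factorial M hM0), subsetConv,
    Finset.sum_eq_single_of_mem S (Finset.mem_powerset_self S)]
  · simp [ha]
  · intro U hU hne
    have : S \ U ≠ ∅ := fun h =>
      hne ((Finset.mem_powerset.1 hU).antisymm (Finset.sdiff_eq_empty_iff_subset.1 h))
    simp [this]
end
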